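/- Let n ≥ 1, 4/3 < p < 4, and p' = p/(p−1). There exists a constant C > 0 such that ‖φ_ν‖_{L^p(ℝⁿ)}‖φ_ν‖_{L^{p'}(ℝⁿ)} ≤ C for all ν ∈ ℕ₀ⁿ. -/

import Mathlib

open MeasureTheory Filter
open scoped ENNReal

noncomputable section

/-- Physicists' Hermite polynomial `H_k` as a real function:
`H_k(t) = (−1)^k e^{t²} (d/dt)^k e^{−t²}`. -/
def hermitePolyFun (k : ℕ) (t : ℝ) : ℝ :=
  (-1 : ℝ) ^ k * Real.exp (t ^ 2) * iteratedDeriv k (fun s => Real.exp (-s ^ 2)) t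

/-- One-dimensional Hermite function `φ_k(t) = (2^k k! √π)^{-1/2} H_k(t) e^{-t²/2}`. -/
def hermiteFun (k : ℕ) (t : ℝ) : ℝ :=
  ((2 : ℝ) ^ k * (Nat.factorial k : ℝ) * Real.sqrt Real.pi) ^ (-(1 : ℝ) / 2) *
    hermitePolyFun k t * Real.exp (-(t ^ 2) / 2)

/-- Hermite function `φ_ν` on `ℝⁿ`, `φ_ν(x) = ∏ⱼ φ_{νⱼ}(xⱼ)`. -/
def hermiteFunPi {n : ℕ} (ν : Fin n → ℕ) (x : Fin n → ℝ) : ℝ :=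
  ∏ j, hermiteFun (ν j) (x j)

/-- Fourier–Hermite coefficient `f̂(φ_ν) = ∫ f(x) φ_ν(x) dx` of a Schwartz function. -/
def hermiteCoeff {n : ℕ} (f : SchwartzMap (Fin n → ℝ) ℂ) (ν : Fin n → ℕ) : ℂ :=
  ∫ x : Fin n → ℝ, f x * (hermiteFunPi ν x : ℂ)

/-- Pseudo-multiplier associated to the harmonic oscillator:
`T_m f(x) = Σ_ν m(x,ν) f̂(φ_ν) φ_ν(x)`. -/
def pseudoMult {n : ℕ} (m : (Fin n → ℝ) → (Fin n → ℕ) → ℂ)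
    (f : SchwartzMap (Fin n → ℝ) ℂ) (x : Fin n → ℝ) : ℂ :=
  ∑' ν : Fin n → ℕ, m x ν * hermiteCoeff f ν * (hermiteFunPi ν x : ℂ)

/-- Inverse Fourier–Hermite transform `𝓕_H⁻¹ u (x) = Σ_ν u(ν) φ_ν(x)`. -/
def fhInv {n : ℕ} (u : (Fin n → ℕ) → ℂ) (x : Fin n → ℝ) : ℂ :=
  ∑' ν : Fin n → ℕ, u ν * (hermiteFunPi ν x : ℂ)

/-- Euclidean Fourier transform on `ℝⁿ` (modelled as `Fin n → ℝ`). -/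
def fourierPi {n : ℕ} (g : (Fin n → ℝ) → ℂ) (x : Fin n → ℝ) : ℂ :=
  ∫ ξ : Fin n → ℝ, Complex.exp (-(2 * Real.pi * (∑ j, x j * ξ j)) * Complex.I) * g ξ

/-- One-dimensional Fourier transform. -/
def fourier1 (g : ℝ → ℂ) (t : ℝ) : ℂ :=
  ∫ τ : ℝ, Complex.exp (-(2 * Real.pi * (t * τ)) * Complex.I) * g τ

/-- Partial derivative in the `j`-th coordinate. -/
def pderiv1 {n : ℕ} (j : Fin n) (f : (Fin n → ℝ) → ℂ) : (Fin n → ℝ) → ℂ :=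
  fun ξ => fderiv ℝ f ξ (Pi.single j 1)

/-- Multi-index partial derivative `∂^α`. -/
def pderivMulti {n : ℕ} (α : Fin n → ℕ) (f : (Fin n → ℝ) → ℂ) : (Fin n → ℝ) → ℂ :=
  (List.finRange n).foldr (fun j g => (pderiv1 j)^[α j] g) f

/-- Forward difference in the `j`-th coordinate. -/
def dDiff {n : ℕ} (j : Fin n) (g : (Fin n → ℕ) → ℂ) : (Fin n → ℕ) → ℂ :=
  fun ν => g (ν + Pi.single j 1) - g ν

/-- Multi-index forward difference `Δ^α`. -/
def dDiffMulti {n : ℕ} (α : Fin n → ℕ) (g : (Fin n → ℕ) → ℂ) : (Fin n → ℕ) → ℂ :=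
  (List.finRange n).foldr (fun j h => (dDiff j)^[α j] h) g

/-- Projection onto the `ℓ`-th Hermite eigenspace: `P_ℓ f = Σ_{|ν|=ℓ} f̂(φ_ν) φ_ν`. -/
def hermiteProj {n : ℕ} (f : SchwartzMap (Fin n → ℝ) ℂ) (ℓ : ℕ) (x : Fin n → ℝ) : ℂ :=
  ∑' ν : Fin n → ℕ, if (∑ j, ν j) = ℓ then hermiteCoeff f ν * (hermiteFunPi ν x : ℂ) else 0

/-- Spectral pseudo-multiplier `m(x,H) f(x) = Σ_ℓ m(x,ℓ) P_ℓ f(x)`. -/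
def spectralPM {n : ℕ} (m : (Fin n → ℝ) → ℝ → ℂ)
    (f : SchwartzMap (Fin n → ℝ) ℂ) (x : Fin n → ℝ) : ℂ :=
  ∑' ℓ : ℕ, m x (ℓ : ℝ) * hermiteProj f ℓ x

/-- Multilinear pseudo-multiplier. -/
def multiPM {n κ : ℕ} (m : (Fin n → ℝ) → (Fin κ → Fin n → ℕ) → ℂ)
    (f : Fin κ → SchwartzMap (Fin n → ℝ) ℂ) (x : Fin n → ℝ) : ℂ :=
  ∑' ν : Fin κ → Fin n → ℕ,
    m x ν * (∏ j, hermiteCoeff (f j) (ν j)) * ∏ j, (hermiteFunPi (ν j) x : ℂ)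

/-- Inverse Fourier–Hermite transform on `ℝ^{nκ}` (modelled as `Fin κ → Fin n → ℝ`). -/
def fhInv2 {n κ : ℕ} (u : (Fin κ → Fin n → ℕ) → ℂ) (z : Fin κ → Fin n → ℝ) : ℂ :=
  ∑' ν : Fin κ → Fin n → ℕ, u ν * ∏ j, (hermiteFunPi (ν j) (z j) : ℂ)

/-- Euclidean Fourier transform on `ℝ^{nκ}` (modelled as `Fin κ → Fin n → ℝ`). -/
def fourierPi2 {n κ : ℕ} (g : (Fin κ → Fin n → ℝ) → ℂ) (z : Fin κ → Fin n → ℝ) : ℂ :=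
  ∫ ξ : Fin κ → Fin n → ℝ,
    Complex.exp (-(2 * Real.pi * (∑ j, ∑ i, z j i * ξ j i)) * Complex.I) * g ξ

/-- The Hermite polynomials in the normalisation of physics, defined by the recurrence
`P_{k+1} = 2 X P_k - derivative P_k` with `P₀ = 1`. -/
def physHermite : ℕ → Polynomial ℝ
  | 0 => 1
  | k + 1 => 2 * Polynomial.X * physHermite k - (physHermite k).derivative

lemma derivative_physHermite_succ (k : ℕ) :
    (physHermite (k + 1)).derivative = 2 * ((k : Polynomial ℝ) + 1) * physHermite k := by
  induction k with
  | zero => simp [physHermite]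
  | succ k ih =>
    rw [physHermite, Polynomial.derivative_sub, ih]
    simp only [Polynomial.derivative_mul, Polynomial.derivative_X, Polynomial.derivative_add,
      Polynomial.derivative_natCast, Polynomial.derivative_one, Polynomial.derivative_ofNat, ih]
    rw [physHermite]
    push_cast
    ring

/-- Hermite's differential equation. -/
lemma derivative_derivative_physHermite (k : ℕ) :
    (physHermite k).derivative.derivative =
      2 * Polynomial.X * (physHermite k).derivative - 2 * (k : Polynomial ℝ) * physHermite k := by
  have h := derivative_physHermite_succ k
  rw [physHermite] at h
  simp only [Polynomial.derivative_sub, Polynomial.derivative_mul, Polynomial.derivative_X,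
    Polynomial.derivative_ofNat] at h
  linear_combination -h

lemma iteratedDeriv_exp_neg_sq (k : ℕ) :
    iteratedDeriv k (fun s : ℝ => Real.exp (-s ^ 2)) =
      fun t => (-1) ^ k * (physHermite k).eval t * Real.exp (-t ^ 2) := by
  induction k with
  | zero => simp [physHermite]
  | succ k ih =>
    rw [iteratedDeriv_succ, ih]
    funext t
    have h1 : HasDerivAt (fun s : ℝ => Real.exp (-s ^ 2)) (Real.exp (-t ^ 2) * (-(2 * t))) t := by
      simpa using ((hasDerivAt_pow 2 t).fun_neg).exp
    have h2 := ((physHermite k).hasDerivAt t).const_mul ((-1 : ℝ) ^ k)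
    rw [(h2.fun_mul h1).deriv]
    simp [physHermite]
    ring

lemma hermitePolyFun_eq (k : ℕ) (t : ℝ) : hermitePolyFun k t = (physHermite k).eval t := by
  rw [hermitePolyFun, iteratedDeriv_exp_neg_sq]
  have h : Real.exp (t ^ 2) * Real.exp (-t ^ 2) = 1 := by rw [← Real.exp_add]; simp
  have h2 : ((-1 : ℝ) ^ k) * (-1) ^ k = 1 := by rw [← mul_pow]; simp
  linear_combination (Polynomial.eval t (physHermite k)) * h2 +
    (Polynomial.eval t (physHermite k)) * (-1 : ℝ) ^ k * (-1) ^ k * h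

/-- The normalising constant of the `k`-th Hermite function. -/
def hermiteNormConst (k : ℕ) : ℝ :=
  ((2 : ℝ) ^ k * (Nat.factorial k : ℝ) * Real.sqrt Real.pi) ^ (-(1 : ℝ) / 2)

lemma hermiteNormConst_sq (k : ℕ) :
    hermiteNormConst k ^ 2 = ((2 : ℝ) ^ k * (Nat.factorial k : ℝ) * Real.sqrt Real.pi)⁻¹ := by
  rw [hermiteNormConst, ← Real.rpow_natCast, ← Real.rpow_mul (by positivity),
    ← Real.rpow_neg_one]
  norm_num

lemma hermiteFun_eq (k : ℕ) (t : ℝ) :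
    hermiteFun k t = hermiteNormConst k * (physHermite k).eval t * Real.exp (-(t ^ 2) / 2) := by
  rw [hermiteFun, hermitePolyFun_eq, hermiteNormConst]

/-- The derivative of the `k`-th Hermite function. -/
def hermiteFunDeriv (k : ℕ) (t : ℝ) : ℝ :=
  hermiteNormConst k * ((physHermite k).derivative.eval t - t * (physHermite k).eval t) *
    Real.exp (-(t ^ 2) / 2)

lemma hasDerivAt_exp_neg_sq_half (t : ℝ) :
    HasDerivAt (fun s : ℝ => Real.exp (-(s ^ 2) / 2)) (Real.exp (-(t ^ 2) / 2) * (-t)) t := by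
  have h := (((hasDerivAt_pow 2 t).fun_neg).div_const 2).exp
  convert h using 2
  norm_num
  ring

lemma hasDerivAt_hermiteFun (k : ℕ) (t : ℝ) :
    HasDerivAt (hermiteFun k) (hermiteFunDeriv k t) t := by
  rw [show hermiteFun k = _ from funext (hermiteFun_eq k)]
  refine ((((physHermite k).hasDerivAt t).const_mul (hermiteNormConst k)).fun_mul
    (hasDerivAt_exp_neg_sq_half t)).congr_deriv ?_
  rw [hermiteFunDeriv]
  ring

lemma hasDerivAt_hermiteFunDeriv (k : ℕ) (t : ℝ) :
    HasDerivAt (hermiteFunDeriv k) ((t ^ 2 - (2 * k + 1)) * hermiteFun k t) t := by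
  have h := ((((physHermite k).derivative.hasDerivAt t).fun_sub
    ((hasDerivAt_id' t).fun_mul ((physHermite k).hasDerivAt t))).const_mul (hermiteNormConst k)).fun_mul
    (hasDerivAt_exp_neg_sq_half t)
  refine h.congr_deriv ?_
  simp only [derivative_derivative_physHermite, hermiteFun_eq]
  simp
  ring

lemma eval_zero_physHermite_add_two (k : ℕ) :
    (physHermite (k + 2)).eval 0 = -(2 * ((k : ℝ) + 1)) * (physHermite k).eval 0 := by
  rw [physHermite, derivative_physHermite_succ]
  simp

lemma hermiteFun_zero_add_two_sq (k : ℕ) :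
    hermiteFun (k + 2) 0 ^ 2 * ((k : ℝ) + 2) = hermiteFun k 0 ^ 2 * ((k : ℝ) + 1) := by
  simp only [hermiteFun_eq, mul_pow, hermiteNormConst_sq, eval_zero_physHermite_add_two]
  have h : Real.sqrt Real.pi ≠ 0 := by positivity
  have h2 : (k.factorial : ℝ) ≠ 0 := by positivity
  simp only [Nat.factorial_succ]
  push_cast
  field_simp
  ring

lemma hermiteFunDeriv_zero_succ_sq (k : ℕ) :
    hermiteFunDeriv (k + 1) 0 ^ 2 = 2 * ((k : ℝ) + 1) * hermiteFun k 0 ^ 2 := by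
  simp only [hermiteFun_eq, hermiteFunDeriv, mul_pow, hermiteNormConst_sq,
    derivative_physHermite_succ]
  have h : Real.sqrt Real.pi ≠ 0 := by positivity
  have h2 : (k.factorial : ℝ) ≠ 0 := by positivity
  simp [Nat.factorial_succ]
  field_simp
  ring

lemma hermiteFun_zero_sq_sq_mul_le (k : ℕ) : (hermiteFun k 0 ^ 2) ^ 2 * ((k : ℝ) + 1) ≤ 1 := by
  induction k using Nat.twoStepInduction with
  | zero =>
    have h : hermiteFun 0 0 ^ 2 = (Real.sqrt Real.pi)⁻¹ := by
      simp [hermiteFun_eq, hermiteNormConst_sq, physHermite]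
    rw [h, inv_pow, Real.sq_sqrt Real.pi_pos.le]
    have := Real.pi_gt_three
    simpa using inv_le_one_of_one_le₀ (by linarith)
  | one => simp [hermiteFun_eq, physHermite]
  | more k ih _ =>
    have h := hermiteFun_zero_add_two_sq k
    set a := hermiteFun (k + 2) 0 ^ 2
    set b := hermiteFun k 0 ^ 2
    have ha : a = b * ((k : ℝ) + 1) / ((k : ℝ) + 2) := by field_simp; linarith
    refine le_trans ?_ ih
    rw [ha]
    push_cast
    rw [div_pow, div_mul_eq_mul_div, div_le_iff₀ (by positivity)]
    have hb : 0 ≤ b ^ 2 * ((k : ℝ) + 1) := by positivity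
    nlinarith

/-- The energy of a Hermite function at the origin is `O(√(2k+1))`. -/
lemma hermiteFun_energy_zero_le (k : ℕ) :
    hermiteFunDeriv k 0 ^ 2 + (2 * k + 1) * hermiteFun k 0 ^ 2 ≤ 4 * Real.sqrt (2 * k + 1) := by
  have key : ∀ j : ℕ, (2 * (j : ℝ) + 1) * hermiteFun j 0 ^ 2 ≤ 2 * Real.sqrt (2 * j + 1) := by
    intro j
    have h := hermiteFun_zero_sq_sq_mul_le j
    refine (sq_le_sq₀ (by positivity) (by positivity)).mp ?_
    rw [mul_pow, mul_pow, Real.sq_sqrt (by positivity)]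
    have hj : (0 : ℝ) ≤ j := by positivity
    nlinarith [mul_le_mul_of_nonneg_left h (show (0 : ℝ) ≤ 2 * (2 * j + 1) by positivity),
      sq_nonneg (hermiteFun j 0 ^ 2)]
  cases k with
  | zero =>
    have h := key 0
    have h0 : hermiteFunDeriv 0 0 = 0 := by simp [hermiteFunDeriv, physHermite]
    rw [h0]
    have : 0 ≤ Real.sqrt (2 * (0 : ℕ) + 1) := Real.sqrt_nonneg _
    linarith
  | succ j =>
    have h := key (j + 1)
    have h2 : 2 * ((j : ℝ) + 1) * hermiteFun j 0 ^ 2 ≤ 2 * Real.sqrt (2 * (j + 1 : ℕ) + 1) := by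
      have h := hermiteFun_zero_sq_sq_mul_le j
      refine (sq_le_sq₀ (by positivity) (by positivity)).mp ?_
      rw [mul_pow, mul_pow, mul_pow, Real.sq_sqrt (by positivity)]
      push_cast
      have hj : (0 : ℝ) ≤ j := by positivity
      nlinarith [mul_le_mul_of_nonneg_left h (show (0 : ℝ) ≤ 4 * (j + 1) by positivity)]
    rw [hermiteFunDeriv_zero_succ_sq]
    linarith

lemma tendsto_eval_mul_exp_neg_sq (R : Polynomial ℝ) :
    Tendsto (fun x => R.eval x * Real.exp (-x ^ 2)) atTop (nhds 0) := by
  have h := R.tendsto_div_exp_atTop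
  refine squeeze_zero_norm' ?_ (by simpa using h.norm)
  filter_upwards [eventually_ge_atTop (1 : ℝ)] with x hx
  rw [norm_mul, Real.norm_eq_abs, Real.norm_eq_abs, Real.abs_exp, div_eq_mul_inv, ← Real.exp_neg]
  gcongr
  nlinarith

lemma hermiteFun_mul_hermiteFunDeriv (k : ℕ) : ∃ R : Polynomial ℝ, ∀ x,
    hermiteFun k x * hermiteFunDeriv k x = R.eval x * Real.exp (-x ^ 2) := by
  refine ⟨Polynomial.C (hermiteNormConst k ^ 2) * physHermite k *
    ((physHermite k).derivative - Polynomial.X * physHermite k), fun x => ?_⟩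
  have h : Real.exp (-x ^ 2) = Real.exp (-(x ^ 2) / 2) * Real.exp (-(x ^ 2) / 2) := by
    rw [← Real.exp_add]; ring_nf
  rw [hermiteFun_eq, hermiteFunDeriv, h]
  simp
  ring

lemma tendsto_hermiteFun_mul_deriv_atTop (k : ℕ) :
    Tendsto (fun x => hermiteFun k x * hermiteFunDeriv k x) atTop (nhds 0) := by
  obtain ⟨R, hR⟩ := hermiteFun_mul_hermiteFunDeriv k
  simpa only [hR] using tendsto_eval_mul_exp_neg_sq R

lemma tendsto_hermiteFun_neg_mul_deriv_atTop (k : ℕ) :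
    Tendsto (fun x => hermiteFun k (-x) * -hermiteFunDeriv k (-x)) atTop (nhds 0) := by
  obtain ⟨R, hR⟩ := hermiteFun_mul_hermiteFunDeriv k
  simpa [hR] using (tendsto_eval_mul_exp_neg_sq (R.comp (-Polynomial.X))).neg

section HermiteOscillator

variable {u v : ℝ → ℝ} {s B l : ℝ}

/-- The shifted potential `l⁶ - x² + B l²`, bounded below by `B l²` on the classically allowed
region `|x| ≤ l³`. -/
def shiftedPotential (B l x : ℝ) : ℝ := l ^ 6 - x ^ 2 + B * l ^ 2

/-- A weighted energy of a solution `u`, with derivative `v`, of `u'' = (x² - l⁶) u`: with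
`a = shiftedPotential ^ (-s)` and `q = l⁶ - x²`, it is `a (v² + q u²) - a' u v + a'' u² / 2`. -/
def weightedEnergy (u v : ℝ → ℝ) (s B l x : ℝ) : ℝ :=
  shiftedPotential B l x ^ (-s) *
    (v x ^ 2 + (l ^ 6 - x ^ 2) * u x ^ 2 - 2 * s * x / shiftedPotential B l x * (u x * v x) +
      (s / shiftedPotential B l x + 2 * s * (s + 1) * x ^ 2 / shiftedPotential B l x ^ 2) * u x ^ 2)

lemma hasDerivAt_shiftedPotential (B l x : ℝ) :
    HasDerivAt (shiftedPotential B l) (-(2 * x)) x := by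
  have h := ((hasDerivAt_pow 2 x).const_sub (l ^ 6)).add_const (B * l ^ 2)
  exact h.congr_deriv (by simp)

lemma hasDerivAt_weightedEnergy (hu : ∀ x, HasDerivAt u (v x) x)
    (hv : ∀ x, HasDerivAt v ((x ^ 2 - l ^ 6) * u x) x) {x : ℝ}
    (hQ : 0 < shiftedPotential B l x) :
    HasDerivAt (weightedEnergy u v s B l)
      (shiftedPotential B l x ^ (-s) * u x ^ 2 * x *
        (4 * s * (l ^ 6 - x ^ 2) / shiftedPotential B l x - 2 +
          6 * s * (s + 1) / shiftedPotential B l x ^ 2 +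
          4 * s * (s + 1) * (s + 2) * x ^ 2 / shiftedPotential B l x ^ 3)) x := by
  have hne := hQ.ne'
  have dQ := hasDerivAt_shiftedPotential B l x
  have dx := hasDerivAt_id' x
  have da := dQ.rpow_const (p := -s) (Or.inl hne)
  rw [Real.rpow_sub_one hne] at da
  have dq := (hasDerivAt_pow 2 x).const_sub (l ^ 6)
  have d1 := ((hv x).fun_pow 2).fun_add (dq.fun_mul ((hu x).fun_pow 2))
  have d2 := ((dx.const_mul (2 * s)).fun_div dQ hne).fun_mul ((hu x).fun_mul (hv x))
  have d3 := (((hasDerivAt_const x s).fun_div dQ hne).fun_add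
    (((hasDerivAt_pow 2 x).const_mul (2 * s * (s + 1))).fun_div (dQ.fun_pow 2)
      (pow_ne_zero 2 hne))).fun_mul ((hu x).fun_pow 2)
  refine (da.fun_mul ((d1.fun_sub d2).fun_add d3)).congr_deriv ?_
  generalize shiftedPotential B l x ^ (-s) = A
  generalize shiftedPotential B l x = Q at *
  field_simp
  push_cast
  ring

lemma shiftedPotential_ge {x : ℝ} (hx0 : 0 ≤ x) (hx : x ≤ l ^ 3) :
    B * l ^ 2 ≤ shiftedPotential B l x := by
  have : x ^ 2 ≤ (l ^ 3) ^ 2 := pow_le_pow_left₀ hx0 hx 2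
  rw [shiftedPotential]
  nlinarith

lemma shiftedPotential_pos (hl : 1 ≤ l) (hB : 1 ≤ B) {x : ℝ} (hx0 : 0 ≤ x) (hx : x ≤ l ^ 3) :
    0 < shiftedPotential B l x :=
  lt_of_lt_of_le (by positivity) (shiftedPotential_ge hx0 hx)

lemma weightedEnergy_antitoneOn (hu : ∀ x, HasDerivAt u (v x) x)
    (hv : ∀ x, HasDerivAt v ((x ^ 2 - l ^ 6) * u x) x) (hl : 1 ≤ l) (hB : 1 ≤ B)
    (hs0 : 0 < s) (hs : s < 1 / 2) (hBs : 12 ≤ (2 - 4 * s) * B) :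
    AntitoneOn (weightedEnergy u v s B l) (Set.Icc 0 (l ^ 3)) := by
  have hd : ∀ x ∈ Set.Icc 0 (l ^ 3), _ := fun x hx =>
    hasDerivAt_weightedEnergy (s := s) hu hv (shiftedPotential_pos hl hB hx.1 hx.2)
  refine antitoneOn_of_deriv_nonpos (convex_Icc _ _)
    (fun x hx => (hd x hx).continuousAt.continuousWithinAt)
    (fun x hx => (hd x (interior_subset hx)).differentiableAt.differentiableWithinAt)
    fun x hx => ?_
  replace hx := interior_subset hx
  rw [(hd x hx).deriv]
  have hQ := shiftedPotential_pos hl hB hx.1 hx.2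
  have hge := shiftedPotential_ge (B := B) hx.1 hx.2
  have hx0 := hx.1
  have hQdef : shiftedPotential B l x = l ^ 6 - x ^ 2 + B * l ^ 2 := rfl
  have hxl : x ^ 2 ≤ l ^ 6 := by
    have : x ^ 2 ≤ (l ^ 3) ^ 2 := pow_le_pow_left₀ hx0 hx.2 2
    nlinarith
  set Q := shiftedPotential B l x
  refine mul_nonpos_of_nonneg_of_nonpos (by positivity) ?_
  have h1 : 4 * s * (l ^ 6 - x ^ 2) / Q ≤ 4 * s := by
    rw [div_le_iff₀ hQ]
    have : 0 ≤ B * l ^ 2 := by positivity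
    nlinarith
  have hl2 : 1 ≤ l ^ 2 := one_le_pow₀ hl
  have hQB : B ≤ Q := by nlinarith
  have h2 : 6 * s * (s + 1) / Q ^ 2 ≤ 4.5 / B := by
    refine div_le_div₀ (by norm_num) (by nlinarith) (by positivity) ?_
    nlinarith
  have h3 : 4 * s * (s + 1) * (s + 2) * x ^ 2 / Q ^ 3 ≤ 7.5 / B := by
    have h4 : B * x ^ 2 ≤ Q ^ 3 := by
      calc B * x ^ 2 ≤ B ^ 3 * l ^ 6 := by
            gcongr
            exact le_self_pow₀ hB (by norm_num)
        _ = (B * l ^ 2) ^ 3 := by ring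
        _ ≤ Q ^ 3 := by gcongr
    have h5 : 4 * s * (s + 1) * (s + 2) ≤ 7.5 := by nlinarith [mul_pos hs0 hs0, mul_pos (mul_pos hs0 hs0) hs0]
    rw [div_le_div_iff₀ (by positivity) (by positivity)]
    calc 4 * s * (s + 1) * (s + 2) * x ^ 2 * B = 4 * s * (s + 1) * (s + 2) * (B * x ^ 2) := by ring
      _ ≤ 7.5 * Q ^ 3 := by gcongr
  have h6 : 4.5 / B + 7.5 / B ≤ 2 - 4 * s := by
    rw [← add_div, div_le_iff₀ (by positivity)]
    linarith
  linarith

/-- The weighted energy controls `u` and `v` pointwise. -/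
lemma le_weightedEnergy (hl : 1 ≤ l) (hB : 1 ≤ B) (hs0 : 0 < s) {x : ℝ} (hx0 : 0 ≤ x)
    (hx : x ≤ l ^ 3) :
    shiftedPotential B l x ^ (-s) * (v x ^ 2 / 2 +
      (l ^ 6 - x ^ 2 + 2 * s * x ^ 2 / shiftedPotential B l x ^ 2) * u x ^ 2) ≤
      weightedEnergy u v s B l x := by
  have hQ := shiftedPotential_pos hl hB hx0 hx
  rw [weightedEnergy]
  set Q := shiftedPotential B l x
  refine mul_le_mul_of_nonneg_left ?_ (by positivity)
  have h1 : 0 ≤ (v x - 2 * s * x / Q * u x) ^ 2 := sq_nonneg _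
  have h2 : 0 ≤ s / Q * u x ^ 2 := by positivity
  have h3 : v x ^ 2 + (l ^ 6 - x ^ 2) * u x ^ 2 - 2 * s * x / Q * (u x * v x) +
      (s / Q + 2 * s * (s + 1) * x ^ 2 / Q ^ 2) * u x ^ 2 -
      (v x ^ 2 / 2 + (l ^ 6 - x ^ 2 + 2 * s * x ^ 2 / Q ^ 2) * u x ^ 2) =
      (v x - 2 * s * x / Q * u x) ^ 2 / 2 + s / Q * u x ^ 2 := by
    field_simp
    ring
  linarith

lemma weightedEnergy_zero_le (hl : 1 ≤ l) (hB : 1 ≤ B) (hs0 : 0 < s) (hs : s < 1 / 2)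
    (hE : v 0 ^ 2 + l ^ 6 * u 0 ^ 2 ≤ 4 * l ^ 3) :
    weightedEnergy u v s B l 0 ≤ 8 * (l ^ 6) ^ (-s) * l ^ 3 := by
  have hQ : shiftedPotential B l 0 = l ^ 6 + B * l ^ 2 := by simp [shiftedPotential]
  have hl6 : 1 ≤ l ^ 6 := one_le_pow₀ hl
  have h0 : 0 ≤ B * l ^ 2 := by positivity
  have hQ1 : 1 ≤ shiftedPotential B l 0 := by linarith
  have h1 : shiftedPotential B l 0 ^ (-s) ≤ (l ^ 6) ^ (-s) :=
    Real.rpow_le_rpow_of_nonpos (by positivity) (by linarith) (by linarith)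
  have h2 : s / shiftedPotential B l 0 ≤ 1 := by
    rw [div_le_one (by linarith)]
    linarith
  rw [weightedEnergy]
  calc _ = shiftedPotential B l 0 ^ (-s) * (v 0 ^ 2 + l ^ 6 * u 0 ^ 2 +
        s / shiftedPotential B l 0 * u 0 ^ 2) := by simp
    _ ≤ (l ^ 6) ^ (-s) * (8 * l ^ 3) := by
        refine mul_le_mul h1 ?_ (by positivity) (by positivity)
        nlinarith [mul_le_mul_of_nonneg_right h2 (sq_nonneg (u 0)),
          mul_le_mul_of_nonneg_right hl6 (sq_nonneg (u 0)), sq_nonneg (v 0)]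
    _ = _ := by ring

lemma mul_shiftedPotential_le (hl : 1 ≤ l) (hB : 1 ≤ B) (hs0 : 0 < s) (hs : s < 1 / 2) {x : ℝ}
    (hx0 : 0 ≤ x) (hx : x ≤ l ^ 3) :
    s / (8 * B ^ 3) * shiftedPotential B l x ≤
      l ^ 6 - x ^ 2 + 2 * s * x ^ 2 / shiftedPotential B l x ^ 2 := by
  have hQ := shiftedPotential_pos hl hB hx0 hx
  have hQdef : shiftedPotential B l x = l ^ 6 - x ^ 2 + B * l ^ 2 := rfl
  have hxl : x ^ 2 ≤ l ^ 6 := by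
    have : x ^ 2 ≤ (l ^ 3) ^ 2 := pow_le_pow_left₀ hx0 hx 2
    nlinarith
  set Q := shiftedPotential B l x
  have hB3 : B ≤ B ^ 3 := le_self_pow₀ hB (by norm_num)
  have hc : 0 ≤ 2 * s * x ^ 2 / Q ^ 2 := by positivity
  rcases le_or_gt (l ^ 6) (2 * (l ^ 6 - x ^ 2)) with h | h
  · have hll : l ^ 2 ≤ l ^ 6 := pow_le_pow_right₀ hl (by norm_num)
    have h1 : s / (8 * B ^ 3) * Q ≤ l ^ 6 - x ^ 2 := by
      rw [div_mul_eq_mul_div, div_le_iff₀ (by positivity)]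
      have h2 : Q ≤ (1 + 2 * B) * (l ^ 6 - x ^ 2) := by nlinarith
      have h3 : 0 ≤ l ^ 6 - x ^ 2 := by linarith
      nlinarith [mul_le_mul_of_nonneg_right hB3 h3, mul_le_mul_of_nonneg_right hB h3]
    linarith
  rcases le_or_gt (B * l ^ 2) (l ^ 6 - x ^ 2) with h' | h'
  · have h1 : s / (8 * B ^ 3) * Q ≤ l ^ 6 - x ^ 2 := by
      rw [div_mul_eq_mul_div, div_le_iff₀ (by positivity)]
      have h3 : 0 ≤ l ^ 6 - x ^ 2 := by linarith
      nlinarith [mul_le_mul_of_nonneg_right hB3 h3, mul_le_mul_of_nonneg_right hB h3]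
    linarith
  · have h1 : s / (8 * B ^ 3) * Q ≤ 2 * s * x ^ 2 / Q ^ 2 := by
      rw [div_mul_eq_mul_div, div_le_div_iff₀ (by positivity) (by positivity)]
      have h2 : Q ^ 3 ≤ (2 * (B * l ^ 2)) ^ 3 := pow_le_pow_left₀ hQ.le (by linarith) 3
      calc s * Q * Q ^ 2 = s * Q ^ 3 := by ring
        _ ≤ s * (2 * (B * l ^ 2)) ^ 3 := by gcongr
        _ = s * l ^ 6 * (8 * B ^ 3) := by ring
        _ ≤ 2 * s * x ^ 2 * (8 * B ^ 3) := by
          gcongr ?_ * (8 * B ^ 3)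
          nlinarith
    linarith

/-- Pointwise bound in the classically allowed region. -/
lemma sq_le_of_le_turningPoint (hu : ∀ x, HasDerivAt u (v x) x)
    (hv : ∀ x, HasDerivAt v ((x ^ 2 - l ^ 6) * u x) x) (hl : 1 ≤ l) (hB : 1 ≤ B)
    (hs0 : 0 < s) (hs : s < 1 / 2) (hBs : 12 ≤ (2 - 4 * s) * B)
    (hE : v 0 ^ 2 + l ^ 6 * u 0 ^ 2 ≤ 4 * l ^ 3) {x : ℝ} (hx0 : 0 ≤ x) (hx : x ≤ l ^ 3) :
    u x ^ 2 ≤ 64 * B ^ 3 / s * ((l ^ 6) ^ (-s) * l ^ 3) * shiftedPotential B l x ^ (s - 1) := by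
  have hQ := shiftedPotential_pos hl hB hx0 hx
  have hF := (le_weightedEnergy (u := u) (v := v) hl hB hs0 hx0 hx).trans
    ((weightedEnergy_antitoneOn hu hv hl hB hs0 hs hBs ⟨le_rfl, hx0.trans hx⟩ ⟨hx0, hx⟩ hx0).trans
      (weightedEnergy_zero_le hl hB hs0 hs hE))
  have hq := mul_shiftedPotential_le hl hB hs0 hs hx0 hx
  set Q := shiftedPotential B l x
  have h1 : Q ^ (-s) * (s / (8 * B ^ 3) * Q * u x ^ 2) ≤ 8 * (l ^ 6) ^ (-s) * l ^ 3 := by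
    refine le_trans (mul_le_mul_of_nonneg_left ?_ (by positivity)) hF
    have := mul_le_mul_of_nonneg_right hq (sq_nonneg (u x))
    linarith [sq_nonneg (v x)]
  have h2 : Q ^ (s - 1) * (Q ^ (-s) * Q) = 1 := by
    rw [← Real.rpow_add_one hQ.ne', ← Real.rpow_add hQ]
    norm_num
  have h3 := mul_le_mul_of_nonneg_left h1
    (show 0 ≤ 8 * B ^ 3 / s * Q ^ (s - 1) by positivity)
  calc u x ^ 2 = u x ^ 2 * (Q ^ (s - 1) * (Q ^ (-s) * Q)) := by rw [h2, mul_one]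
    _ = 8 * B ^ 3 / s * Q ^ (s - 1) * (Q ^ (-s) * (s / (8 * B ^ 3) * Q * u x ^ 2)) := by
      field_simp
    _ ≤ _ := h3
    _ = _ := by ring

lemma abs_mul_turningPoint_le (hu : ∀ x, HasDerivAt u (v x) x)
    (hv : ∀ x, HasDerivAt v ((x ^ 2 - l ^ 6) * u x) x) (hl : 1 ≤ l) (hB : 1 ≤ B)
    (hs0 : 0 < s) (hs : s < 1 / 2) (hBs : 12 ≤ (2 - 4 * s) * B)
    (hE : v 0 ^ 2 + l ^ 6 * u 0 ^ 2 ≤ 4 * l ^ 3) :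
    |u (l ^ 3) * v (l ^ 3)| ≤
      4 * B / s * ((l ^ 6) ^ (-s) * l ^ 3) * (B * l ^ 2) ^ s * l⁻¹ := by
  have hL0 : 0 ≤ l ^ 3 := by positivity
  have hF := (le_weightedEnergy (u := u) (v := v) hl hB hs0 hL0 le_rfl).trans
    ((weightedEnergy_antitoneOn hu hv hl hB hs0 hs hBs ⟨le_rfl, hL0⟩ ⟨hL0, le_rfl⟩ hL0).trans
      (weightedEnergy_zero_le hl hB hs0 hs hE))
  have hQ : shiftedPotential B l (l ^ 3) = B * l ^ 2 := by rw [shiftedPotential]; ring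
  rw [hQ] at hF
  have hK : 0 < B * l ^ 2 := by positivity
  have h1 : (2 * s * l / B) * |u (l ^ 3) * v (l ^ 3)| ≤ v (l ^ 3) ^ 2 / 2 +
      (l ^ 6 - (l ^ 3) ^ 2 + 2 * s * (l ^ 3) ^ 2 / (B * l ^ 2) ^ 2) * u (l ^ 3) ^ 2 := by
    have h2 : l ^ 6 - (l ^ 3) ^ 2 + 2 * s * (l ^ 3) ^ 2 / (B * l ^ 2) ^ 2 = 2 * s * (l / B) ^ 2 := by
      field_simp
      ring
    rw [h2, abs_mul]
    have h3 : 0 ≤ (|v (l ^ 3)| - 2 * s * (l / B) * |u (l ^ 3)|) ^ 2 := sq_nonneg _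
    have h4 : 0 ≤ 2 * s * (1 - s) * (l / B) ^ 2 * |u (l ^ 3)| ^ 2 := by
      have : 0 ≤ 1 - s := by linarith
      positivity
    rw [← sq_abs (u _), ← sq_abs (v _), mul_div_assoc]
    nlinarith
  have h5 := (mul_le_mul_of_nonneg_left h1
    (show 0 ≤ (B * l ^ 2) ^ (-s) by positivity)).trans hF
  have h6 : (B * l ^ 2) ^ s * (B * l ^ 2) ^ (-s) = 1 := by
    rw [← Real.rpow_add hK]; simp
  have h7 := mul_le_mul_of_nonneg_left h5
    (show 0 ≤ B / (2 * s * l) * (B * l ^ 2) ^ s by positivity)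
  calc |u (l ^ 3) * v (l ^ 3)|
      = |u (l ^ 3) * v (l ^ 3)| * ((B * l ^ 2) ^ s * (B * l ^ 2) ^ (-s)) := by rw [h6, mul_one]
    _ = B / (2 * s * l) * (B * l ^ 2) ^ s *
        ((B * l ^ 2) ^ (-s) * ((2 * s * l / B) * |u (l ^ 3) * v (l ^ 3)|)) := by
      field_simp
    _ ≤ _ := h7
    _ = _ := by field_simp; ring

lemma hasDerivAt_mul_deriv (hu : ∀ x, HasDerivAt u (v x) x)
    (hv : ∀ x, HasDerivAt v ((x ^ 2 - l ^ 6) * u x) x) (x : ℝ) :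
    HasDerivAt (fun y => u y * v y) (v x ^ 2 + (x ^ 2 - l ^ 6) * u x ^ 2) x :=
  ((hu x).fun_mul (hv x)).congr_deriv (by ring)

lemma mul_deriv_nonpos (hu : ∀ x, HasDerivAt u (v x) x)
    (hv : ∀ x, HasDerivAt v ((x ^ 2 - l ^ 6) * u x) x) (hl : 1 ≤ l)
    (hlim : Tendsto (fun x => u x * v x) atTop (nhds 0)) {x : ℝ} (hx : l ^ 3 ≤ x) :
    u x * v x ≤ 0 := by
  have hd := hasDerivAt_mul_deriv hu hv
  have hmono : MonotoneOn (fun y => u y * v y) (Set.Ici (l ^ 3)) := by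
    refine monotoneOn_of_deriv_nonneg (convex_Ici _)
      (fun y _ => (hd y).continuousAt.continuousWithinAt)
      (fun y _ => (hd y).differentiableAt.differentiableWithinAt) fun y hy => ?_
    rw [(hd y).deriv]
    have hy' : l ^ 3 ≤ y := interior_subset hy
    have : 0 ≤ y ^ 2 - l ^ 6 := by
      have := pow_le_pow_left₀ (by positivity) hy' 2
      nlinarith
    positivity
  refine ge_of_tendsto hlim ?_
  filter_upwards [eventually_ge_atTop x] with y hy
  exact hmono hx (hx.trans hy) hy

lemma sq_antitoneOn (hu : ∀ x, HasDerivAt u (v x) x)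
    (hv : ∀ x, HasDerivAt v ((x ^ 2 - l ^ 6) * u x) x) (hl : 1 ≤ l)
    (hlim : Tendsto (fun x => u x * v x) atTop (nhds 0)) :
    AntitoneOn (fun x => u x ^ 2) (Set.Ici (l ^ 3)) := by
  have hd : ∀ x, HasDerivAt (fun x => u x ^ 2) (2 * (u x * v x)) x := fun x =>
    ((hu x).fun_pow 2).congr_deriv (by push_cast; ring)
  refine antitoneOn_of_deriv_nonpos (convex_Ici _)
    (fun y _ => (hd y).continuousAt.continuousWithinAt)
    (fun y _ => (hd y).differentiableAt.differentiableWithinAt) fun y hy => ?_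
  rw [(hd y).deriv]
  linarith [mul_deriv_nonpos hu hv hl hlim (interior_subset hy)]

/-- Decay in the classically forbidden region. -/
lemma mul_sq_le_of_turningPoint_le (hu : ∀ x, HasDerivAt u (v x) x)
    (hv : ∀ x, HasDerivAt v ((x ^ 2 - l ^ 6) * u x) x) (hl : 1 ≤ l)
    (hlim : Tendsto (fun x => u x * v x) atTop (nhds 0)) {x : ℝ} (hx : l ^ 3 ≤ x) :
    l ^ 3 * (x - l ^ 3) ^ 2 * u x ^ 2 ≤ |u (l ^ 3) * v (l ^ 3)| := by
  have hd : ∀ y, HasDerivAt (fun y => u y * v y - u x ^ 2 * (l ^ 3 * (y - l ^ 3) ^ 2))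
      (v y ^ 2 + (y ^ 2 - l ^ 6) * u y ^ 2 - u x ^ 2 * (l ^ 3 * (2 * (y - l ^ 3)))) y := by
    intro y
    have h := ((((hasDerivAt_id' y).sub_const (l ^ 3)).fun_pow 2).const_mul (l ^ 3)).const_mul
      (u x ^ 2)
    refine ((hasDerivAt_mul_deriv hu hv y).fun_sub h).congr_deriv ?_
    push_cast
    ring
  have hmono : MonotoneOn (fun y => u y * v y - u x ^ 2 * (l ^ 3 * (y - l ^ 3) ^ 2))
      (Set.Icc (l ^ 3) x) := by
    refine monotoneOn_of_deriv_nonneg (convex_Icc _ _)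
      (fun y _ => (hd y).continuousAt.continuousWithinAt)
      (fun y _ => (hd y).differentiableAt.differentiableWithinAt) fun y hy => ?_
    rw [(hd y).deriv]
    replace hy := interior_subset hy
    have h1 : u x ^ 2 ≤ u y ^ 2 := sq_antitoneOn hu hv hl hlim hy.1 hx hy.2
    have h2 : l ^ 3 * (2 * (y - l ^ 3)) ≤ y ^ 2 - l ^ 6 := by nlinarith [sq_nonneg (y - l ^ 3)]
    have h3 : 0 ≤ y - l ^ 3 := by linarith [hy.1]
    have h4 : (l ^ 3 * (2 * (y - l ^ 3))) * u x ^ 2 ≤ (y ^ 2 - l ^ 6) * u y ^ 2 :=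
      mul_le_mul h2 h1 (by positivity) (le_trans (by positivity) h2)
    linarith [sq_nonneg (v y)]
  have h := hmono ⟨le_rfl, hx⟩ ⟨hx, le_rfl⟩ hx
  simp only [sub_self] at h
  linarith [mul_deriv_nonpos hu hv hl hlim hx, neg_le_abs (u (l ^ 3) * v (l ^ 3))]

lemma setLIntegral_Ioo_sub_rpow {b L : ℝ} (hb : b < 1) (hL : 0 < L) :
    ∫⁻ x in Set.Ioo 0 L, ENNReal.ofReal ((L - x) ^ (-b)) =
      ENNReal.ofReal (L ^ (1 - b) / (1 - b)) := by
  have h1 := (Measure.measurePreserving_sub_left (volume : Measure ℝ) L).setLIntegral_comp_preimage_emb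
    (MeasurableEquiv.subLeft L).measurableEmbedding
    (fun y => ENNReal.ofReal (y ^ (-b))) (Set.Ioo 0 L)
  have h2 : (fun x => L - x) ⁻¹' Set.Ioo 0 L = Set.Ioo 0 L := by simp
  rw [h2] at h1
  have hint := (intervalIntegral.intervalIntegrable_rpow' (a := 0) (b := L)
    (show -1 < -b by linarith)).1
  rw [h1, Measure.restrict_congr_set Ioo_ae_eq_Ioc, ← ofReal_integral_eq_lintegral_ofReal hint,
    ← intervalIntegral.integral_of_le hL.le, integral_rpow (Or.inl (by linarith))]
  · rw [Real.zero_rpow (by linarith), sub_zero, neg_add_eq_sub]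
  · filter_upwards [ae_restrict_mem measurableSet_Ioc] with x hx
    exact Real.rpow_nonneg hx.1.le _

lemma setLIntegral_Ioi_sub_rpow {p L c : ℝ} (hp : 1 < p) (hc : 0 < c) :
    ∫⁻ x in Set.Ioi (L + c), ENNReal.ofReal ((x - L) ^ (-p)) =
      ENNReal.ofReal (c ^ (1 - p) / (p - 1)) := by
  have h1 := (measurePreserving_sub_right (volume : Measure ℝ) L).setLIntegral_comp_preimage_emb
    (MeasurableEquiv.subRight L).measurableEmbedding
    (fun y => ENNReal.ofReal (y ^ (-p))) (Set.Ioi c)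
  have h2 : (fun x => x - L) ⁻¹' Set.Ioi c = Set.Ioi (L + c) := by simp [add_comm]
  rw [h2] at h1
  rw [h1, ← ofReal_integral_eq_lintegral_ofReal
    (integrableOn_Ioi_rpow_of_lt (by linarith) hc),
    integral_Ioi_rpow_of_lt (by linarith) hc, neg_add_eq_sub, neg_div, ← div_neg, neg_sub]
  filter_upwards [ae_restrict_mem measurableSet_Ioi] with x hx
  exact Real.rpow_nonneg (hc.le.trans (le_of_lt hx)) _

lemma ofReal_abs_rpow_le {y M p : ℝ} (hp : 0 < p) (h : y ^ 2 ≤ M) :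
    ENNReal.ofReal (|y| ^ p) ≤ ENNReal.ofReal (M ^ (p / 2)) := by
  refine ENNReal.ofReal_le_ofReal ?_
  have h1 : |y| ^ p = (y ^ 2) ^ (p / 2) := by
    rw [← sq_abs, ← Real.rpow_natCast, ← Real.rpow_mul (abs_nonneg y)]
    congr 1
    push_cast
    ring
  rw [h1]
  exact Real.rpow_le_rpow (sq_nonneg y) h (by positivity)

/-- The `L^p` bound on a half-line for solutions of `u'' = (x² - l⁶) u` decaying at infinity. -/
lemma setLIntegral_Ioi_rpow_le (hu : ∀ x, HasDerivAt u (v x) x)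
    (hv : ∀ x, HasDerivAt v ((x ^ 2 - l ^ 6) * u x) x) (hl : 1 ≤ l) (hB : 1 ≤ B)
    (hs0 : 0 < s) (hs : s < 1 / 2) (hBs : 12 ≤ (2 - 4 * s) * B)
    (hE : v 0 ^ 2 + l ^ 6 * u 0 ^ 2 ≤ 4 * l ^ 3)
    (hlim : Tendsto (fun x => u x * v x) atTop (nhds 0)) {p : ℝ} (hp : 1 < p)
    (hps : p * (1 - s) / 2 < 1) :
    ∫⁻ x in Set.Ioi 0, ENNReal.ofReal (|u x| ^ p) ≤
      ENNReal.ofReal ((64 * B ^ 3 / s) ^ (p / 2) *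
        (1 / (1 - p * (1 - s) / 2) + (1 + 1 / (p - 1))) * l ^ (3 - 3 * p / 2)) := by
  have hl0 : 0 < l := by linarith
  have hL : 0 < l ^ 3 := by positivity
  have hp0 : 0 < p := by linarith
  have hpow6 : (l ^ 6) ^ (-s) = l ^ (-6 * s) := by
    rw [← Real.rpow_natCast, ← Real.rpow_mul hl0.le]
    congr 1; push_cast; ring
  have hpow3 : l ^ 3 = l ^ (3 : ℝ) := by rw [← Real.rpow_natCast]; norm_num
  have hpow2 : l ^ 2 = l ^ (2 : ℝ) := by rw [← Real.rpow_natCast]; norm_num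
  set D := 64 * B ^ 3 / s with hD
  have hD0 : 0 < D := by positivity
  set b := p * (1 - s) / 2 with hb
  have hb1 : 0 < 1 - b := by linarith
  have hp1 : 0 < p - 1 := by linarith
  have hlex : ∀ {r t : ℝ}, r ≤ t → l ^ r ≤ l ^ t := fun h => Real.rpow_le_rpow_of_exponent_le hl h
  -- the classically allowed region
  have hin : ∫⁻ x in Set.Ioo 0 (l ^ 3), ENNReal.ofReal (|u x| ^ p) ≤
      ENNReal.ofReal (D ^ (p / 2) * (1 / (1 - b)) * l ^ (3 - 3 * p / 2)) := by
    calc _ ≤ ∫⁻ x in Set.Ioo 0 (l ^ 3), ENNReal.ofReal (D ^ (p / 2) * l ^ (-3 * s * p / 2)) *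
          ENNReal.ofReal ((l ^ 3 - x) ^ (-b)) := by
          refine setLIntegral_mono' measurableSet_Ioo fun x hx => ?_
          have hx' : 0 < l ^ 3 - x := by linarith [hx.2]
          have h1 := sq_le_of_le_turningPoint hu hv hl hB hs0 hs hBs hE hx.1.le hx.2.le
          have h2 : shiftedPotential B l x ^ (s - 1) ≤ (l ^ 3 * (l ^ 3 - x)) ^ (s - 1) := by
            refine Real.rpow_le_rpow_of_nonpos (by positivity) ?_ (by linarith)
            have : 0 ≤ B * l ^ 2 := by positivity
            rw [shiftedPotential]
            nlinarith [mul_pos hx.1 hx']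
          refine (ofReal_abs_rpow_le hp0 (h1.trans
            (mul_le_mul_of_nonneg_left h2 (by positivity)))).trans_eq ?_
          rw [← ENNReal.ofReal_mul (by positivity), hpow6,
            Real.mul_rpow (by positivity) (by positivity),
            Real.mul_rpow (by positivity) (by positivity),
            Real.mul_rpow (x := l ^ 3) (by positivity) (by positivity),
            Real.mul_rpow (x := (l ^ 3) ^ (s - 1)) (by positivity) (by positivity),
            ← Real.rpow_mul hx'.le, hpow3, ← Real.rpow_mul hl0.le, ← Real.rpow_mul hl0.le,
            ← Real.rpow_add hl0, ← Real.rpow_mul hl0.le, mul_assoc (D ^ (p / 2)),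
            ← mul_assoc (l ^ _), ← Real.rpow_add hl0, ← mul_assoc]
          congr 4
          · ring
          · rw [hb]; ring
      _ = _ := by
          rw [lintegral_const_mul' _ _ ENNReal.ofReal_ne_top, setLIntegral_Ioo_sub_rpow hps hL,
            ← ENNReal.ofReal_mul (by positivity), hpow3, ← Real.rpow_mul hl0.le, mul_div_assoc',
            mul_assoc, ← Real.rpow_add hl0]
          congr 1
          rw [show -3 * s * p / 2 + 3 * (1 - b) = 3 - 3 * p / 2 by rw [hb]; ring]
          ring
  -- the value at the turning point
  have hturn : u (l ^ 3) ^ 2 ≤ D * l ^ (1 - 4 * s) := by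
    have h1 := sq_le_of_le_turningPoint hu hv hl hB hs0 hs hBs hE hL.le le_rfl
    have hQ : shiftedPotential B l (l ^ 3) = B * l ^ 2 := by rw [shiftedPotential]; ring
    have hB1 : B ^ (s - 1) ≤ 1 := Real.rpow_le_one_of_one_le_of_nonpos hB (by linarith)
    rw [hQ, hpow6, Real.mul_rpow (by positivity) (by positivity), hpow2, hpow3,
      ← Real.rpow_mul hl0.le, ← Real.rpow_add hl0] at h1
    rw [hpow3]
    calc _ ≤ _ := h1
      _ ≤ D * l ^ (-6 * s + 3) * (1 * l ^ (2 * (s - 1))) := by gcongr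
      _ = D * l ^ (1 - 4 * s) := by
        rw [one_mul, mul_assoc, ← Real.rpow_add hl0]
        ring_nf
  have hexp : p / 2 * (1 - 4 * s) - 1 ≤ 3 - 3 * p / 2 := by
    have : p * (1 - s) ≤ 2 := by linarith
    nlinarith
  have hmid : ∫⁻ x in Set.Icc (l ^ 3) (l ^ 3 + l⁻¹), ENNReal.ofReal (|u x| ^ p) ≤
      ENNReal.ofReal (D ^ (p / 2) * l ^ (3 - 3 * p / 2)) := by
    calc _ ≤ ∫⁻ x in Set.Icc (l ^ 3) (l ^ 3 + l⁻¹),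
          ENNReal.ofReal (D ^ (p / 2) * l ^ (p / 2 * (1 - 4 * s))) := by
          refine setLIntegral_mono' measurableSet_Icc fun x hx => ?_
          have h1 : u x ^ 2 ≤ u (l ^ 3) ^ 2 :=
            sq_antitoneOn hu hv hl hlim Set.self_mem_Ici hx.1 hx.1
          refine (ofReal_abs_rpow_le hp0 (h1.trans hturn)).trans_eq ?_
          rw [Real.mul_rpow (by positivity) (by positivity), ← Real.rpow_mul hl0.le, mul_comm (p / 2)]
      _ = ENNReal.ofReal (D ^ (p / 2) * l ^ (p / 2 * (1 - 4 * s) - 1)) := by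
          rw [setLIntegral_const, Real.volume_Icc, ← ENNReal.ofReal_mul (by positivity),
            Real.rpow_sub_one hl0.ne']
          congr 1
          ring
      _ ≤ _ := by
          refine ENNReal.ofReal_le_ofReal (mul_le_mul_of_nonneg_left (hlex hexp) (by positivity))
  -- the classically forbidden region
  have hout : ∫⁻ x in Set.Ioi (l ^ 3 + l⁻¹), ENNReal.ofReal (|u x| ^ p) ≤
      ENNReal.ofReal (D ^ (p / 2) * (1 / (p - 1)) * l ^ (3 - 3 * p / 2)) := by
    have huv : |u (l ^ 3) * v (l ^ 3)| ≤ D * l ^ (2 - 4 * s) := by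
      have h1 := abs_mul_turningPoint_le hu hv hl hB hs0 hs hBs hE
      have hB1 : B ^ s ≤ B := by
        simpa using Real.rpow_le_rpow_of_exponent_le hB (show s ≤ 1 by linarith)
      have hBD : 4 * B / s * B ≤ D := by
        rw [hD, div_mul_eq_mul_div]
        refine div_le_div_of_nonneg_right ?_ hs0.le
        nlinarith [pow_le_pow_right₀ hB (show 2 ≤ 3 by norm_num), sq_nonneg B]
      rw [hpow6, Real.mul_rpow (by positivity) (by positivity), hpow2,
        ← Real.rpow_mul hl0.le, ← Real.rpow_neg_one l] at h1
      refine h1.trans ?_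
      rw [hpow3, ← Real.rpow_add hl0]
      calc _ = 4 * B / s * B ^ s * (l ^ (-6 * s + 3) * l ^ (2 * s) * l ^ (-1 : ℝ)) := by ring
        _ ≤ D * (l ^ (-6 * s + 3) * l ^ (2 * s) * l ^ (-1 : ℝ)) := by
          gcongr
          exact le_trans (by gcongr) hBD
        _ = D * l ^ (2 - 4 * s) := by
          rw [← Real.rpow_add hl0, ← Real.rpow_add hl0]
          ring_nf
    calc _ ≤ ∫⁻ x in Set.Ioi (l ^ 3 + l⁻¹),
          ENNReal.ofReal (D ^ (p / 2) * l ^ (p / 2 * (-1 - 4 * s))) *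
          ENNReal.ofReal ((x - l ^ 3) ^ (-p)) := by
          refine setLIntegral_mono' measurableSet_Ioi fun x hx => ?_
          have hx1 : l ^ 3 + l⁻¹ < x := hx
          have hinv : 0 < l⁻¹ := by positivity
          have hx' : 0 < x - l ^ 3 := by linarith
          have h1 := (mul_sq_le_of_turningPoint_le hu hv hl hlim
            (show l ^ 3 ≤ x by linarith)).trans huv
          have h2 : u x ^ 2 ≤ D * l ^ (-1 - 4 * s) * (x - l ^ 3) ^ (-2 : ℝ) := by
            rw [← mul_le_mul_iff_right₀ (show 0 < l ^ 3 * (x - l ^ 3) ^ 2 by positivity)]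
            refine h1.trans_eq ?_
            have h3 : (x - l ^ 3) ^ 2 * (x - l ^ 3) ^ (-2 : ℝ) = 1 := by
              rw [← Real.rpow_natCast, ← Real.rpow_add hx']; norm_num
            have h4 : l ^ 3 * l ^ (-1 - 4 * s) = l ^ (2 - 4 * s) := by
              rw [hpow3, ← Real.rpow_add hl0]; ring_nf
            calc _ = D * (l ^ 3 * l ^ (-1 - 4 * s)) *
                  ((x - l ^ 3) ^ 2 * (x - l ^ 3) ^ (-2 : ℝ)) := by rw [h3, h4, mul_one]
              _ = _ := by ring
          refine (ofReal_abs_rpow_le hp0 h2).trans_eq ?_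
          rw [← ENNReal.ofReal_mul (by positivity), Real.mul_rpow (by positivity) (by positivity),
            Real.mul_rpow (by positivity) (by positivity), ← Real.rpow_mul hl0.le,
            ← Real.rpow_mul hx'.le, mul_comm (p / 2)]
          ring_nf
      _ = ENNReal.ofReal (D ^ (p / 2) * (1 / (p - 1)) * l ^ (p / 2 * (1 - 4 * s) - 1)) := by
          rw [lintegral_const_mul' _ _ ENNReal.ofReal_ne_top,
            setLIntegral_Ioi_sub_rpow hp (by positivity), ← ENNReal.ofReal_mul (by positivity),
            ← Real.rpow_neg_one l, ← Real.rpow_mul hl0.le, mul_div_assoc', mul_assoc,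
            ← Real.rpow_add hl0]
          rw [show p / 2 * (-1 - 4 * s) + -1 * (1 - p) = p / 2 * (1 - 4 * s) - 1 by ring]
          ring_nf
      _ ≤ _ := by
          refine ENNReal.ofReal_le_ofReal (mul_le_mul_of_nonneg_left (hlex hexp) (by positivity))
  have hcover : Set.Ioi (0 : ℝ) ⊆
      Set.Ioo 0 (l ^ 3) ∪ (Set.Icc (l ^ 3) (l ^ 3 + l⁻¹) ∪ Set.Ioi (l ^ 3 + l⁻¹)) := by
    intro x hx
    rcases lt_or_ge x (l ^ 3) with h | h
    · exact Or.inl ⟨hx, h⟩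
    rcases le_or_gt x (l ^ 3 + l⁻¹) with h' | h'
    · exact Or.inr (Or.inl ⟨h, h'⟩)
    · exact Or.inr (Or.inr h')
  calc _ ≤ _ := lintegral_mono_set hcover
    _ ≤ _ := (lintegral_union_le _ _ _).trans (add_le_add le_rfl (lintegral_union_le _ _ _))
    _ ≤ _ := add_le_add hin (add_le_add hmid hout)
    _ = _ := by
      rw [← ENNReal.ofReal_add (by positivity) (by positivity),
        ← ENNReal.ofReal_add (by positivity) (by positivity)]
      congr 1
      ring

end HermiteOscillator

lemma lintegral_eq_add_Ioi_neg (f : ℝ → ℝ≥0∞) :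
    ∫⁻ x, f x = (∫⁻ x in Set.Ioi 0, f x) + ∫⁻ x in Set.Ioi 0, f (-x) := by
  have h := (Measure.measurePreserving_neg (volume : Measure ℝ)).setLIntegral_comp_preimage_emb
    (MeasurableEquiv.neg ℝ).measurableEmbedding f (Set.Iio 0)
  have h2 : (Neg.neg : ℝ → ℝ) ⁻¹' Set.Iio 0 = Set.Ioi 0 := by simp
  rw [h2] at h
  rw [h, ← lintegral_add_compl f (measurableSet_Ioi (a := (0 : ℝ))), Set.compl_Ioi,
    Measure.restrict_congr_set Iio_ae_eq_Iic]

lemma continuous_hermiteFun (k : ℕ) : Continuous (hermiteFun k) :=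
  continuous_iff_continuousAt.mpr fun t => (hasDerivAt_hermiteFun k t).continuousAt

/-- The sharp `L^p` bound for one-dimensional Hermite functions, for `1 < p < 4`. -/
lemma exists_lintegral_hermiteFun_rpow_le {p : ℝ} (hp1 : 1 < p) (hp2 : p < 4) :
    ∃ K > (0 : ℝ), ∀ k : ℕ, ∫⁻ x, ENNReal.ofReal (|hermiteFun k x| ^ p) ≤
      ENNReal.ofReal (K * (2 * k + 1 : ℝ) ^ (1 / 2 - p / 4)) := by
  have hp0 : 0 < p := by linarith
  have h2p : 1 / 2 < 2 / p := by
    rw [div_lt_div_iff₀ (by norm_num) hp0]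
    linarith
  obtain ⟨s, hs1, hs⟩ := exists_between (show max 0 (1 - 2 / p) < 1 / 2 from
    max_lt (by norm_num) (by linarith))
  obtain ⟨hs0, hs2⟩ := max_lt_iff.mp hs1
  have hps : p * (1 - s) / 2 < 1 := by
    have : 1 - s < 2 / p := by linarith
    rw [lt_div_iff₀ hp0] at this
    linarith
  set B := max 1 (12 / (2 - 4 * s))
  have hB : 1 ≤ B := le_max_left _ _
  have hBs : 12 ≤ (2 - 4 * s) * B := by
    have : 12 / (2 - 4 * s) ≤ B := le_max_right _ _
    rwa [div_le_iff₀' (by linarith)] at this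
  set M := (64 * B ^ 3 / s) ^ (p / 2) * (1 / (1 - p * (1 - s) / 2) + (1 + 1 / (p - 1)))
  have hM : 0 < M := by
    have h1 : 0 < 1 - p * (1 - s) / 2 := by linarith
    have h2 : 0 < p - 1 := by linarith
    positivity
  refine ⟨M + M, by positivity, fun k => ?_⟩
  have hk : (0 : ℝ) < 2 * k + 1 := by positivity
  set l := (2 * k + 1 : ℝ) ^ ((1 : ℝ) / 6) with hl_def
  have hl : 1 ≤ l := Real.one_le_rpow (by linarith [(Nat.cast_nonneg k : (0 : ℝ) ≤ k)]) (by norm_num)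
  have hl6 : l ^ 6 = 2 * k + 1 := by
    rw [hl_def, ← Real.rpow_natCast, ← Real.rpow_mul hk.le]; norm_num
  have hl3 : l ^ 3 = Real.sqrt (2 * k + 1) := by
    rw [hl_def, ← Real.rpow_natCast, ← Real.rpow_mul hk.le, Real.sqrt_eq_rpow]; norm_num
  have hlp : l ^ (3 - 3 * p / 2) = (2 * k + 1 : ℝ) ^ (1 / 2 - p / 4) := by
    rw [hl_def, ← Real.rpow_mul hk.le]; ring_nf
  have hv : ∀ x, HasDerivAt (hermiteFunDeriv k) ((x ^ 2 - l ^ 6) * hermiteFun k x) x := by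
    rw [hl6]; exact hasDerivAt_hermiteFunDeriv k
  have hE : hermiteFunDeriv k 0 ^ 2 + l ^ 6 * hermiteFun k 0 ^ 2 ≤ 4 * l ^ 3 := by
    rw [hl6, hl3]; exact hermiteFun_energy_zero_le k
  have hpos := setLIntegral_Ioi_rpow_le (hasDerivAt_hermiteFun k) hv hl hB hs0 hs hBs hE
    (tendsto_hermiteFun_mul_deriv_atTop k) hp1 hps
  have hneg := setLIntegral_Ioi_rpow_le (u := fun x => hermiteFun k (-x))
    (v := fun x => -hermiteFunDeriv k (-x))
    (fun x => ((hasDerivAt_hermiteFun k (-x)).scomp x (hasDerivAt_neg x)).congr_deriv (by simp))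
    (fun x => ((hv (-x)).scomp x (hasDerivAt_neg x)).fun_neg.congr_deriv (by simp))
    hl hB hs0 hs hBs (by simpa using hE) (tendsto_hermiteFun_neg_mul_deriv_atTop k) hp1 hps
  rw [lintegral_eq_add_Ioi_neg, add_mul, ← hlp, ENNReal.ofReal_add (by positivity) (by positivity)]
  exact add_le_add hpos hneg

lemma exists_eLpNorm_hermiteFunPi_le (n : ℕ) {p : ℝ} (hp1 : 1 < p) (hp2 : p < 4) :
    ∃ K > (0 : ℝ), ∀ ν : Fin n → ℕ, eLpNorm (hermiteFunPi ν) (ENNReal.ofReal p) volume ≤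
      ENNReal.ofReal (K * ∏ j, (2 * ν j + 1 : ℝ) ^ (1 / (2 * p) - 1 / 4)) := by
  have hp0 : 0 < p := by linarith
  obtain ⟨K, hK, hbound⟩ := exists_lintegral_hermiteFun_rpow_le hp1 hp2
  refine ⟨(K ^ (1 / p)) ^ n, by positivity, fun ν => ?_⟩
  have hnn : ∀ k x, 0 ≤ |hermiteFun k x| ^ p := fun k x => by positivity
  have hint : ∀ k, Integrable (fun x => |hermiteFun k x| ^ p) := fun k => by
    refine ⟨((continuous_hermiteFun k).abs.rpow_const
      fun _ => Or.inr hp0.le).aestronglyMeasurable, ?_⟩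
    rw [hasFiniteIntegral_iff_ofReal (ae_of_all _ (hnn k))]
    exact (hbound k).trans_lt ENNReal.ofReal_lt_top
  have hle : ∀ k : ℕ, ∫ x, |hermiteFun k x| ^ p ≤ K * (2 * k + 1 : ℝ) ^ (1 / 2 - p / 4) := fun k => by
    rw [← ENNReal.ofReal_le_ofReal_iff (by positivity),
      ofReal_integral_eq_lintegral_ofReal (hint k) (ae_of_all _ (hnn k))]
    exact hbound k
  have hlint : ∫⁻ x, ‖hermiteFunPi ν x‖ₑ ^ p ≤
      ENNReal.ofReal (∏ j, K * (2 * ν j + 1 : ℝ) ^ (1 / 2 - p / 4)) := by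
    have h1 : ∀ x, ‖hermiteFunPi ν x‖ₑ ^ p = ENNReal.ofReal (∏ j, |hermiteFun (ν j) (x j)| ^ p) := by
      intro x
      rw [hermiteFunPi, Real.enorm_eq_ofReal_abs,
        ENNReal.ofReal_rpow_of_nonneg (abs_nonneg _) hp0.le, Finset.abs_prod,
        Real.finsetProd_rpow _ _ fun _ _ => abs_nonneg _]
    simp_rw [h1]
    rw [← ofReal_integral_eq_lintegral_ofReal]
    · rw [integral_fintype_prod_volume_eq_prod (fun j t => |hermiteFun (ν j) t| ^ p)]
      exact ENNReal.ofReal_le_ofReal (Finset.prod_le_prod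
        (fun j _ => integral_nonneg (hnn _)) fun j _ => hle _)
    · exact Integrable.fintype_prod (f := fun j t => |hermiteFun (ν j) t| ^ p) fun j => hint (ν j)
    · exact ae_of_all _ fun x => Finset.prod_nonneg fun j _ => hnn _ _
  rw [eLpNorm_eq_lintegral_rpow_enorm_toReal (by simpa using hp0) ENNReal.ofReal_ne_top,
    ENNReal.toReal_ofReal hp0.le]
  refine (ENNReal.rpow_le_rpow hlint (by positivity)).trans_eq ?_
  rw [ENNReal.ofReal_rpow_of_nonneg (by positivity) (by positivity),
    ← Real.finsetProd_rpow _ _ fun _ _ => by positivity]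
  congr 1
  rw [← Fin.prod_const n (K ^ (1 / p)), ← Finset.prod_mul_distrib]
  refine Finset.prod_congr rfl fun j _ => ?_
  rw [Real.mul_rpow hK.le (by positivity), ← Real.rpow_mul (by positivity)]
  congr 2
  field_simp

theorem stmt3 (n : ℕ) (hn : 1 ≤ n) (p : ℝ) (hp1 : 4 / 3 < p) (hp2 : p < 4) :
    ∃ C > (0 : ℝ), ∀ ν : Fin n → ℕ,
      eLpNorm (hermiteFunPi ν) (ENNReal.ofReal p) volume *
        eLpNorm (hermiteFunPi ν) (ENNReal.ofReal (p / (p - 1))) volume ≤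
        ENNReal.ofReal C := by
  have hp : 0 < p - 1 := by linarith
  obtain ⟨K, hK, hKb⟩ := exists_eLpNorm_hermiteFunPi_le n (p := p) (by linarith) hp2
  obtain ⟨K', hK', hKb'⟩ := exists_eLpNorm_hermiteFunPi_le n (p := p / (p - 1))
    (by rw [lt_div_iff₀ hp]; linarith) (by rw [div_lt_iff₀ hp]; linarith)
  refine ⟨K * K', by positivity, fun ν => (mul_le_mul' (hKb ν) (hKb' ν)).trans_eq ?_⟩
  rw [← ENNReal.ofReal_mul (by positivity), mul_mul_mul_comm, ← Finset.prod_mul_distrib,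
    Finset.prod_eq_one, mul_one]
  intro j _
  have hp0 : p ≠ 0 := (show (0 : ℝ) < p by linarith).ne'
  have he : 1 / (2 * p) - 1 / 4 + (1 / (2 * (p / (p - 1))) - 1 / 4) = 0 := by
    field_simp
    ring
  rw [← Real.rpow_add (by positivity), he, Real.rpow_zero]
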